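/- arXiv:2310.00306 — 6 statements merged into one kernel-verified Lean document; each statement's English description precedes it below -/
import Mathlib

section
/- If h : S → X is |RL| ν-integrable on S, then h is |RL| ν-integrable on every set E ∈ 𝒞. -/
open Filter Topology

/-- A countable partition of `E` (indexed by `ℕ`): pairwise disjoint measurable sets whose
union is `E`.  Sets are allowed to be empty so that finite partitions are also included;
since `ν ∅ = 0`, empty pieces contribute nothing to the Riemann–Lebesgue sums. -/
def IsCtblePartition {S : Type*} [MeasurableSpace S] (E : Set S) (A : ℕ → Set S) : Prop :=
  (∀ n, MeasurableSet (A n)) ∧ Pairwise (Function.onFun Disjoint A) ∧ (⋃ n, A n) = E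

/-- `P'` is finer than `P`: every set of `P'` is included in some set of `P`. -/
def FinerThan {S : Type*} (P P' : ℕ → Set S) : Prop := ∀ n, ∃ m, P' n ⊆ P m

/-- `t` is a choice of tags for the partition `P` : `t n ∈ P n` whenever `P n ≠ ∅`. -/
def AreTags {S : Type*} (P : ℕ → Set S) (t : ℕ → S) : Prop := ∀ n, (P n).Nonempty → t n ∈ P n

/-- `h : S → X` is absolutely Riemann–Lebesgue `ν`-integrable on `E` with integral `a`:
for every `ε > 0` there is a countable partition `P₀` of `E` such that for every finer
countable partition `P = {A_n}` of `E`, `h` is bounded on every `A_n` with `ν (A_n) > 0`,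
and for every choice of tags `s_n ∈ A_n` the series `Σ_n h (s_n) • ν (A_n)` converges
absolutely with `‖Σ_n h (s_n) • ν (A_n) - a‖ < ε`. -/
def AbsRL {S : Type*} [MeasurableSpace S] {X : Type*} [NormedAddCommGroup X] [NormedSpace ℝ X]
    (ν : Set S → ℝ) (h : S → X) (E : Set S) (a : X) : Prop :=
  ∀ ε > 0, ∃ P₀ : ℕ → Set S, IsCtblePartition E P₀ ∧
    ∀ P : ℕ → Set S, IsCtblePartition E P → FinerThan P₀ P →
      (∀ n, 0 < ν (P n) → ∃ M, ∀ s ∈ P n, ‖h s‖ ≤ M) ∧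
      ∀ t : ℕ → S, AreTags P t →
        Summable (fun n => ‖ν (P n) • h (t n)‖) ∧
        ‖(∑' n, ν (P n) • h (t n)) - a‖ < ε

/-- `h : S → X` is (unconditionally) Riemann–Lebesgue `ν`-integrable on `E` with integral `a`:
as `AbsRL`, but the series is only required to converge unconditionally. -/
def RL {S : Type*} [MeasurableSpace S] {X : Type*} [NormedAddCommGroup X] [NormedSpace ℝ X]
    (ν : Set S → ℝ) (h : S → X) (E : Set S) (a : X) : Prop :=
  ∀ ε > 0, ∃ P₀ : ℕ → Set S, IsCtblePartition E P₀ ∧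
    ∀ P : ℕ → Set S, IsCtblePartition E P → FinerThan P₀ P →
      (∀ n, 0 < ν (P n) → ∃ M, ∀ s ∈ P n, ‖h s‖ ≤ M) ∧
      ∀ t : ℕ → S, AreTags P t →
        Summable (fun n => ν (P n) • h (t n)) ∧
        ‖(∑' n, ν (P n) • h (t n)) - a‖ < ε

/-- `h` is Birkhoff simple `ν`-integrable on `E` with integral `b`. -/
def BirkhoffSimple {S : Type*} [MeasurableSpace S] {X : Type*} [NormedAddCommGroup X]
    [NormedSpace ℝ X] (ν : Set S → ℝ) (h : S → X) (E : Set S) (b : X) : Prop :=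
  ∀ ε > 0, ∃ P₀ : ℕ → Set S, IsCtblePartition E P₀ ∧
    ∀ P : ℕ → Set S, IsCtblePartition E P → FinerThan P₀ P →
      ∀ t : ℕ → S, AreTags P t →
        Filter.limsup (fun n => ‖(∑ k ∈ Finset.range (n + 1), ν (P k) • h (t k)) - b‖)
          Filter.atTop < ε

/-- The set of all finite sums `Σ_i ν (A_i)` over finite pairwise disjoint families of
measurable sets contained in `E`. -/
def variationSet {S : Type*} [MeasurableSpace S] (ν : Set S → ℝ) (E : Set S) : Set ℝ :=
  { x | ∃ (k : ℕ) (A : Fin k → Set S), (∀ i, MeasurableSet (A i)) ∧ (∀ i, A i ⊆ E) ∧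
        Pairwise (Function.onFun Disjoint A) ∧ x = ∑ i, ν (A i) }

/-- The variation `ν̄ (E)` of a set function `ν`. -/
noncomputable def variation {S : Type*} [MeasurableSpace S] (ν : Set S → ℝ) (E : Set S) : ℝ :=
  sSup (variationSet ν E)

/-- `ν` is of finite variation (on `S`). -/
def FiniteVariation {S : Type*} [MeasurableSpace S] (ν : Set S → ℝ) : Prop :=
  BddAbove (variationSet ν Set.univ)

/-- The semivariation `ν̃ (A) = inf { ν̄ (B) : A ⊆ B, B measurable }`. -/
noncomputable def semivariation {S : Type*} [MeasurableSpace S] (ν : Set S → ℝ)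
    (A : Set S) : ℝ :=
  sInf { x | ∃ B : Set S, MeasurableSet B ∧ A ⊆ B ∧ x = variation ν B }

/-- A finite partition of `E`, indexed by `Fin k` (pieces may be empty). -/
def IsFinPartition {S : Type*} [MeasurableSpace S] (E : Set S) {k : ℕ}
    (A : Fin k → Set S) : Prop :=
  (∀ i, MeasurableSet (A i)) ∧ Pairwise (Function.onFun Disjoint A) ∧ (⋃ i, A i) = E

/-- `h` is Gould `ν`-integrable on `E` with integral `a`. -/
def Gould {S : Type*} [MeasurableSpace S] (ν : Set S → ℝ) (h : S → ℝ) (E : Set S)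
    (a : ℝ) : Prop :=
  ∀ ε > 0, ∃ (k : ℕ) (P₀ : Fin k → Set S), IsFinPartition E P₀ ∧
    ∀ (l : ℕ) (P : Fin l → Set S), IsFinPartition E P → (∀ j, ∃ i, P j ⊆ P₀ i) →
      ∀ t : Fin l → S, (∀ j, (P j).Nonempty → t j ∈ P j) →
        |(∑ j, ν (P j) * h (t j)) - a| < ε

/-- Condition (E) for a set function `μ` (defined at least on the measurable sets). -/
def ConditionE {S : Type*} [MeasurableSpace S] (μ : Set S → ℝ) : Prop :=
  ∀ B : ℕ → ℕ → Set S, (∀ m n, MeasurableSet (B m n)) →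
    (∀ m, Antitone fun n => B m n) →
    μ (⋃ m, ⋂ n, B m n) = 0 →
    ∃ np mp : ℕ → ℕ, StrictMono np ∧ StrictMono mp ∧
      Filter.Tendsto (fun k => μ (⋃ p, ⋃ (_ : k ≤ p), B (mp p) (np p)))
        Filter.atTop (nhds 0)

/-- The sets of two sequences merged into a single sequence; it also merges tags. -/
def seqMerge {α : Type*} (u v : ℕ → α) (n : ℕ) : α :=
  Sum.elim u v (Equiv.natSumNatEquivNat.symm n)

/-- The common refinement of two sequences of sets. -/
def commonRefinement {S : Type*} (P Q : ℕ → Set S) (n : ℕ) : Set S :=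
  P n.unpair.1 ∩ Q n.unpair.2

section Partition

variable {S : Type*}

lemma forall_seqMerge {α : Type*} {u v : ℕ → α} {p : α → Prop} (hu : ∀ n, p (u n))
    (hv : ∀ n, p (v n)) (n : ℕ) : p (seqMerge u v n) := by
  unfold seqMerge
  cases Equiv.natSumNatEquivNat.symm n with
  | inl k => exact hu k
  | inr k => exact hv k

lemma seqMerge_inl {α : Type*} (u v : ℕ → α) (n : ℕ) :
    seqMerge u v (Equiv.natSumNatEquivNat (Sum.inl n)) = u n := by
  simp only [seqMerge, Equiv.symm_apply_apply, Sum.elim_inl]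

lemma seqMerge_inr {α : Type*} (u v : ℕ → α) (n : ℕ) :
    seqMerge u v (Equiv.natSumNatEquivNat (Sum.inr n)) = v n := by
  simp only [seqMerge, Equiv.symm_apply_apply, Sum.elim_inr]

lemma IsCtblePartition.subset [MeasurableSpace S] {E : Set S} {A : ℕ → Set S}
    (hA : IsCtblePartition E A) (n : ℕ) : A n ⊆ E :=
  hA.2.2 ▸ Set.subset_iUnion A n

lemma IsCtblePartition.seqMerge_compl [MeasurableSpace S] {E : Set S} {A C : ℕ → Set S}
    (hA : IsCtblePartition E A) (hC : IsCtblePartition Eᶜ C) :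
    IsCtblePartition Set.univ (seqMerge A C) := by
  refine ⟨forall_seqMerge hA.1 hC.1, ?_, ?_⟩
  · have key : ∀ x y : ℕ ⊕ ℕ, x ≠ y → Disjoint (Sum.elim A C x) (Sum.elim A C y) := by
      rintro (i | i) (j | j) hij
      · exact hA.2.1 fun e => hij (congrArg _ e)
      · exact disjoint_compl_right.mono (hA.subset i) (hC.subset j)
      · exact disjoint_compl_left.mono (hC.subset i) (hA.subset j)
      · exact hC.2.1 fun e => hij (congrArg _ e)
    exact fun m n hmn => key _ _ fun e => hmn (Equiv.natSumNatEquivNat.symm.injective e)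
  · refine Set.eq_univ_of_forall fun x => Set.mem_iUnion.2 ?_
    by_cases hx : x ∈ E
    · rw [← hA.2.2] at hx
      obtain ⟨n, hn⟩ := Set.mem_iUnion.1 hx
      exact ⟨Equiv.natSumNatEquivNat (Sum.inl n), by rwa [seqMerge_inl]⟩
    · rw [← Set.mem_compl_iff, ← hC.2.2] at hx
      obtain ⟨n, hn⟩ := Set.mem_iUnion.1 hx
      exact ⟨Equiv.natSumNatEquivNat (Sum.inr n), by rwa [seqMerge_inr]⟩

lemma AreTags.seqMerge {A C : ℕ → Set S} {t u : ℕ → S} (ht : AreTags A t) (hu : AreTags C u) :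
    AreTags (seqMerge A C) (seqMerge t u) := by
  intro n
  unfold _root_.seqMerge
  cases Equiv.natSumNatEquivNat.symm n with
  | inl k => exact ht k
  | inr k => exact hu k

lemma exists_areTags [Nonempty S] (P : ℕ → Set S) : ∃ t, AreTags P t := by
  classical
  exact ⟨fun n => if hn : (P n).Nonempty then hn.some else Classical.arbitrary S,
    fun n hn => by simpa only [dif_pos hn] using hn.some_mem⟩

lemma IsCtblePartition.commonRefinement [MeasurableSpace S] {E F : Set S} {P Q : ℕ → Set S}
    (hP : IsCtblePartition E P) (hQ : IsCtblePartition F Q) :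
    IsCtblePartition (E ∩ F) (commonRefinement P Q) := by
  refine ⟨fun n => (hP.1 _).inter (hQ.1 _), fun m n hmn => ?_, ?_⟩
  · by_cases h₁ : m.unpair.1 = n.unpair.1
    · have h₂ : m.unpair.2 ≠ n.unpair.2 := fun h₂ => hmn <| by
        rw [← Nat.pair_unpair m, ← Nat.pair_unpair n, h₁, h₂]
      exact (hQ.2.1 h₂).mono Set.inter_subset_right Set.inter_subset_right
    · exact (hP.2.1 h₁).mono Set.inter_subset_left Set.inter_subset_left
  · ext x
    rw [← hP.2.2, ← hQ.2.2]
    simp only [_root_.commonRefinement, Set.mem_iUnion, Set.mem_inter_iff]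
    constructor
    · rintro ⟨n, h₁, h₂⟩
      exact ⟨⟨_, h₁⟩, ⟨_, h₂⟩⟩
    · rintro ⟨⟨i, hi⟩, ⟨j, hj⟩⟩
      exact ⟨Nat.pair i j, by simpa only [Nat.unpair_pair] using ⟨hi, hj⟩⟩

lemma finerThan_commonRefinement_left (P Q : ℕ → Set S) : FinerThan P (commonRefinement P Q) :=
  fun _ => ⟨_, Set.inter_subset_left⟩

lemma finerThan_commonRefinement_right (P Q : ℕ → Set S) : FinerThan Q (commonRefinement P Q) :=
  fun _ => ⟨_, Set.inter_subset_right⟩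

lemma IsCtblePartition.inter [MeasurableSpace S] {F E : Set S} {P : ℕ → Set S}
    (hP : IsCtblePartition F P) (hE : MeasurableSet E) :
    IsCtblePartition (F ∩ E) fun n => P n ∩ E :=
  ⟨fun n => (hP.1 n).inter hE,
    fun _ _ hmn => (hP.2.1 hmn).mono Set.inter_subset_left Set.inter_subset_left,
    by rw [← Set.iUnion_inter, hP.2.2]⟩

end Partition

section Sum

variable {X : Type*} [NormedAddCommGroup X]

lemma summable_left_of_seqMerge [CompleteSpace X] {f g : ℕ → X}
    (hs : Summable (seqMerge f g)) : Summable f := by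
  have hs' := hs.comp_injective (Equiv.natSumNatEquivNat.injective.comp Sum.inl_injective)
  exact hs'.congr fun n => seqMerge_inl f g n

lemma summable_right_of_seqMerge [CompleteSpace X] {f g : ℕ → X}
    (hs : Summable (seqMerge f g)) : Summable g := by
  have hs' := hs.comp_injective (Equiv.natSumNatEquivNat.injective.comp Sum.inr_injective)
  exact hs'.congr fun n => seqMerge_inr f g n

lemma tsum_seqMerge {f g : ℕ → X} (hf : Summable f) (hg : Summable g) :
    ∑' n, seqMerge f g n = ∑' n, f n + ∑' n, g n := by
  have hfg : HasSum (Sum.elim f g) (∑' n, f n + ∑' n, g n) :=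
    HasSum.sum hf.hasSum hg.hasSum
  exact (Equiv.natSumNatEquivNat.symm.hasSum_iff.2 hfg).tsum_eq

end Sum

section Integral

variable {S : Type*} {X : Type*} [NormedAddCommGroup X] [NormedSpace ℝ X]

lemma seqMerge_smul (ν : Set S → ℝ) (h : S → X) (A C : ℕ → Set S) (t u : ℕ → S) (n : ℕ) :
    ν (seqMerge A C n) • h (seqMerge t u n) =
      seqMerge (fun k => ν (A k) • h (t k)) (fun k => ν (C k) • h (u k)) n := by
  unfold seqMerge
  cases Equiv.natSumNatEquivNat.symm n <;> rfl

/-- If `h` is `|RL|`-integrable on the whole space, then its Riemann–Lebesgue sums over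
sufficiently fine partitions of `E` converge absolutely and are close to each other. -/
lemma AbsRL.exists_partition_sums_close [MeasurableSpace S] [Nonempty S] [CompleteSpace X]
    {ν : Set S → ℝ} {h : S → X} {a : X} (ha : AbsRL ν h Set.univ a) {E : Set S} (hE : MeasurableSet E)
    {ε : ℝ} (hε : 0 < ε) :
    ∃ R : ℕ → Set S, IsCtblePartition E R ∧
      (∀ P, IsCtblePartition E P → FinerThan R P →
        (∀ n, 0 < ν (P n) → ∃ M, ∀ s ∈ P n, ‖h s‖ ≤ M) ∧
        ∀ t, AreTags P t → Summable fun n => ‖ν (P n) • h (t n)‖) ∧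
      ∀ P Q, IsCtblePartition E P → FinerThan R P → IsCtblePartition E Q → FinerThan R Q →
        ∀ t u, AreTags P t → AreTags Q u →
          ‖(∑' n, ν (P n) • h (t n)) - ∑' n, ν (Q n) • h (u n)‖ < ε := by
  obtain ⟨P₀, hP₀, H⟩ := ha (ε / 2) (half_pos hε)
  have hC : IsCtblePartition Eᶜ fun n => P₀ n ∩ Eᶜ := by
    simpa only [Set.univ_inter] using hP₀.inter hE.compl
  set C : ℕ → Set S := fun n => P₀ n ∩ Eᶜ
  obtain ⟨w, hw⟩ := exists_areTags C
  have key : ∀ P, IsCtblePartition E P → FinerThan (fun n => P₀ n ∩ E) P →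
      (∀ n, 0 < ν (P n) → ∃ M, ∀ s ∈ P n, ‖h s‖ ≤ M) ∧
      ∀ t, AreTags P t → (Summable fun n => ‖ν (P n) • h (t n)‖) ∧
        ‖(∑' n, ν (P n) • h (t n)) + (∑' n, ν (C n) • h (w n)) - a‖ < ε / 2 := by
    intro P hP hfine
    obtain ⟨hbdd, hsum⟩ := H (seqMerge P C) (hP.seqMerge_compl hC) <|
      forall_seqMerge (p := fun B => ∃ m, B ⊆ P₀ m)
        (fun n => (hfine n).imp fun _ hm => hm.trans Set.inter_subset_left)
        fun n => ⟨n, Set.inter_subset_left⟩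
    refine ⟨fun n hn => ?_, fun t ht => ?_⟩
    · simpa only [seqMerge_inl, hn, forall_const] using hbdd (Equiv.natSumNatEquivNat (Sum.inl n))
    · obtain ⟨hs, hlt⟩ := hsum _ (ht.seqMerge hw)
      have hs' := hs.of_norm
      simp only [seqMerge_smul] at hs' hlt
      rw [tsum_seqMerge (summable_left_of_seqMerge hs') (summable_right_of_seqMerge hs')] at hlt
      refine ⟨?_, hlt⟩
      have := hs.comp_injective (Equiv.natSumNatEquivNat.injective.comp Sum.inl_injective)
      exact this.congr fun n => by simp only [Function.comp_apply, seqMerge_inl]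
  refine ⟨fun n => P₀ n ∩ E, by simpa only [Set.univ_inter] using hP₀.inter hE,
    fun P hP hf => ⟨(key P hP hf).1, fun t ht => ((key P hP hf).2 t ht).1⟩,
    fun P Q hP hPf hQ hQf t u ht hu => ?_⟩
  have h₁ := ((key P hP hPf).2 t ht).2
  have h₂ := ((key Q hQ hQf).2 u hu).2
  rw [← dist_eq_norm] at h₁ h₂ ⊢
  rw [← dist_add_right _ _ (∑' n, ν (C n) • h (w n))]
  linarith [dist_triangle_right ((∑' n, ν (P n) • h (t n)) + ∑' n, ν (C n) • h (w n))
    ((∑' n, ν (Q n) • h (u n)) + ∑' n, ν (C n) • h (w n)) a]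

end Integral

/-- If `h : S → X` is `|RL|` `ν`-integrable on `S`, then `h` is `|RL|`
`ν`-integrable on every set `E ∈ 𝒞`. -/
theorem absRL_integrableOn_of_integrable
    {S : Type*} [Nonempty S] [MeasurableSpace S]
    {X : Type*} [NormedAddCommGroup X] [NormedSpace ℝ X] [CompleteSpace X]
    (ν : Set S → ℝ) (hν0 : ν ∅ = 0) (hνnn : ∀ A : Set S, MeasurableSet A → 0 ≤ ν A)
    (h : S → X) (a : X) (ha : AbsRL ν h Set.univ a)
    (E : Set S) (hE : MeasurableSet E) :
    ∃ b : X, AbsRL ν h E b := by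
  choose R hR hRsum hRclose using fun k : ℕ =>
    ha.exists_partition_sums_close hE (Nat.one_div_pos_of_nat (α := ℝ) (n := k))
  choose t ht using fun k => exists_areTags (R k)
  have hrefl : ∀ k, FinerThan (R k) (R k) := fun k n => ⟨n, subset_rfl⟩
  set x : ℕ → X := fun k => ∑' n, ν (R k n) • h (t k n)
  have hx : ∀ k l, dist (x k) (x l) ≤ 1 / ((k : ℝ) + 1) + 1 / ((l : ℝ) + 1) := by
    intro k l
    have hQ : IsCtblePartition E (commonRefinement (R k) (R l)) := by
      simpa only [Set.inter_self] using (hR k).commonRefinement (hR l)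
    obtain ⟨u, hu⟩ := exists_areTags (commonRefinement (R k) (R l))
    have h₁ := hRclose k _ _ (hR k) (hrefl k) hQ (finerThan_commonRefinement_left _ _) _ _ (ht k) hu
    have h₂ := hRclose l _ _ (hR l) (hrefl l) hQ (finerThan_commonRefinement_right _ _) _ _
      (ht l) hu
    rw [← dist_eq_norm] at h₁ h₂
    exact (dist_triangle_right _ _ _).trans (add_le_add h₁.le h₂.le)
  have hlim := tendsto_one_div_add_atTop_nhds_zero_nat (𝕜 := ℝ)
  have hcauchy : CauchySeq x := by
    refine Metric.cauchySeq_iff.2 fun ε hε => ?_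
    obtain ⟨N, hN⟩ := eventually_atTop.1 (hlim.eventually_lt_const (half_pos hε))
    exact ⟨N, fun k hk l hl => by linarith [hx k l, hN k hk, hN l hl]⟩
  obtain ⟨b, hb⟩ := cauchySeq_tendsto_of_complete hcauchy
  refine ⟨b, fun ε hε => ?_⟩
  obtain ⟨k, hk, hkb⟩ := ((hlim.eventually_lt_const (half_pos hε)).and
    (hb.eventually (Metric.ball_mem_nhds b (half_pos hε)))).exists
  refine ⟨R k, hR k, fun P hP hf => ⟨(hRsum k P hP hf).1, fun s hs =>
    ⟨(hRsum k P hP hf).2 s hs, ?_⟩⟩⟩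
  have h₁ := hRclose k _ _ hP hf (hR k) (hrefl k) _ _ hs (ht k)
  rw [← dist_eq_norm] at h₁ ⊢
  have h₂ : dist (x k) b < ε / 2 := hkb
  linarith [dist_triangle (∑' n, ν (P n) • h (s n)) (x k) b]
end

section
/- Let ν₁, ν₂ : 𝒞 → [0,∞) be set functions with ν₁(∅) = ν₂(∅) = 0. If h : S → X is |RL| ν₁-integrable and |RL| ν₂-integrable on S, then h is |RL| (ν₁+ν₂)-integrable on S and (|RL|)∫_S h d(ν₁+ν₂) = (|RL|)∫_S h dν₁ + (|RL|)∫_S h dν₂. -/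
open Filter Topology

/-- Any two countable partitions of a set have a common countable refinement. -/
theorem IsCtblePartition.exists_common_refinement {S : Type*} [MeasurableSpace S] {E : Set S}
    {P Q : ℕ → Set S} (hP : IsCtblePartition E P) (hQ : IsCtblePartition E Q) :
    ∃ R : ℕ → Set S, IsCtblePartition E R ∧ FinerThan P R ∧ FinerThan Q R := by
  refine ⟨fun n => P n.unpair.1 ∩ Q n.unpair.2, ⟨fun n => (hP.1 _).inter (hQ.1 _), ?_, ?_⟩,
    fun n => ⟨_, Set.inter_subset_left⟩, fun n => ⟨_, Set.inter_subset_right⟩⟩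
  · intro m n hmn
    by_cases h₁ : m.unpair.1 = n.unpair.1
    · have h₂ : m.unpair.2 ≠ n.unpair.2 := fun h₂ => hmn <| by
        rw [← Nat.pair_unpair m, ← Nat.pair_unpair n, h₁, h₂]
      exact (hQ.2.1 h₂).mono Set.inter_subset_right Set.inter_subset_right
    · exact (hP.2.1 h₁).mono Set.inter_subset_left Set.inter_subset_left
  · rw [Set.iUnion_unpair fun i j => P i ∩ Q j]
    simp_rw [← Set.inter_iUnion, hQ.2.2]
    rw [← Set.iUnion_inter, hP.2.2, Set.inter_self]

theorem FinerThan.trans {S : Type*} {P Q R : ℕ → Set S} (hPQ : FinerThan P Q)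
    (hQR : FinerThan Q R) : FinerThan P R := fun n =>
  let ⟨m, hm⟩ := hQR n
  let ⟨k, hk⟩ := hPQ m
  ⟨k, hm.trans hk⟩

/-- additivity of the `|RL|` integral in the set function. -/
theorem absRL_add_setFunction
    {S : Type*} [Nonempty S] [MeasurableSpace S]
    {X : Type*} [NormedAddCommGroup X] [NormedSpace ℝ X] [CompleteSpace X]
    (ν₁ ν₂ : Set S → ℝ) (hν₁0 : ν₁ ∅ = 0) (hν₂0 : ν₂ ∅ = 0)
    (hν₁nn : ∀ A : Set S, MeasurableSet A → 0 ≤ ν₁ A)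
    (hν₂nn : ∀ A : Set S, MeasurableSet A → 0 ≤ ν₂ A)
    (h : S → X) (a₁ a₂ : X)
    (h₁ : AbsRL ν₁ h Set.univ a₁) (h₂ : AbsRL ν₂ h Set.univ a₂) :
    AbsRL (fun A => ν₁ A + ν₂ A) h Set.univ (a₁ + a₂) := by
  intro ε hε
  obtain ⟨P₁, hP₁, H₁⟩ := h₁ (ε / 2) (half_pos hε)
  obtain ⟨P₂, hP₂, H₂⟩ := h₂ (ε / 2) (half_pos hε)
  obtain ⟨R, hR, hR₁, hR₂⟩ := hP₁.exists_common_refinement hP₂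
  refine ⟨R, hR, fun P hP hRP => ?_⟩
  obtain ⟨B₁, T₁⟩ := H₁ P hP (hR₁.trans hRP)
  obtain ⟨B₂, T₂⟩ := H₂ P hP (hR₂.trans hRP)
  refine ⟨fun n hn => ?_, fun t ht => ?_⟩
  · by_cases hpos : 0 < ν₁ (P n)
    · exact B₁ n hpos
    · exact B₂ n (by linarith)
  · obtain ⟨S₁, L₁⟩ := T₁ t ht
    obtain ⟨S₂, L₂⟩ := T₂ t ht
    simp only [add_smul]
    refine ⟨(S₁.add S₂).of_nonneg_of_le (fun _ => norm_nonneg _) fun _ => norm_add_le _ _, ?_⟩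
    rw [S₁.of_norm.tsum_add S₂.of_norm, add_sub_add_comm]
    exact (norm_add_le _ _).trans_lt (by linarith)
end

section
/- If ν is of finite variation, h : S → X is bounded, and the semivariation of the set {s ∈ S : h(s) ≠ 0} is zero (i.e. ν̃({s : h(s) ≠ 0}) = 0), then h is |RL| ν-integrable on S and (|RL|)∫_S h dν = 0. -/
open Filter Topology

theorem bddAbove_variationSet {S : Type*} [MeasurableSpace S] {ν : Set S → ℝ}
    (hfv : FiniteVariation ν) (B : Set S) : BddAbove (variationSet ν B) := by
  refine hfv.mono ?_
  rintro x ⟨k, A, hA, -, hd, rfl⟩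
  exact ⟨k, A, hA, fun i => Set.subset_univ _, hd, rfl⟩

theorem sum_range_le_variation {S : Type*} [MeasurableSpace S] {ν : Set S → ℝ}
    (hfv : FiniteVariation ν) {B : Set S} {A : ℕ → Set S} (hA : ∀ n, MeasurableSet (A n))
    (hd : Pairwise (Function.onFun Disjoint A)) (hB : ∀ n, A n ⊆ B) (n : ℕ) :
    ∑ i ∈ Finset.range n, ν (A i) ≤ variation ν B :=
  le_csSup (bddAbove_variationSet hfv B)
    ⟨n, fun i => A i, fun i => hA i, fun i => hB i,
      fun _ _ hij => hd (Fin.val_injective.ne hij), Finset.sum_range _⟩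

theorem exists_variation_lt_of_semivariation_eq_zero {S : Type*} [MeasurableSpace S]
    {ν : Set S → ℝ} {A : Set S} (hA : semivariation ν A = 0) {δ : ℝ} (hδ : 0 < δ) :
    ∃ B, MeasurableSet B ∧ A ⊆ B ∧ variation ν B < δ := by
  have hne : {x | ∃ B : Set S, MeasurableSet B ∧ A ⊆ B ∧ x = variation ν B}.Nonempty :=
    ⟨_, Set.univ, MeasurableSet.univ, Set.subset_univ _, rfl⟩
  obtain ⟨_, ⟨B, hBm, hAB, rfl⟩, hB⟩ := exists_lt_of_csInf_lt hne (hA.trans_lt hδ)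
  exact ⟨B, hBm, hAB, hB⟩

theorem exists_isCtblePartition_univ_pair {S : Type*} [MeasurableSpace S] {B : Set S}
    (hB : MeasurableSet B) :
    ∃ P : ℕ → Set S, IsCtblePartition Set.univ P ∧ ∀ n, P n ⊆ B ∨ P n ⊆ Bᶜ := by
  refine ⟨fun n => if n = 0 then B else if n = 1 then Bᶜ else ∅, ⟨fun n => ?_, ?_, ?_⟩,
    fun n => ?_⟩
  · dsimp only
    split_ifs
    exacts [hB, hB.compl, MeasurableSet.empty]
  · intro i j hij
    dsimp only [Function.onFun]
    split_ifs <;> first | omega | simp [disjoint_compl_right, disjoint_compl_left]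
  · refine Set.eq_univ_of_forall fun s => Set.mem_iUnion.2 ?_
    by_cases hs : s ∈ B
    · exact ⟨0, by simpa using hs⟩
    · exact ⟨1, by simpa using hs⟩
  · dsimp only
    split_ifs <;> simp

/-- if `ν` is of finite variation, `h` is bounded and `h = 0` `ν`-a.e.
(i.e. `ν̃({s : h s ≠ 0}) = 0`), then `h` is `|RL|` `ν`-integrable with integral `0`. -/
theorem absRL_zero_of_ae_zero
    {S : Type*} [Nonempty S] [MeasurableSpace S]
    {X : Type*} [NormedAddCommGroup X] [NormedSpace ℝ X] [CompleteSpace X]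
    (ν : Set S → ℝ) (hν0 : ν ∅ = 0) (hνnn : ∀ A : Set S, MeasurableSet A → 0 ≤ ν A)
    (hfv : FiniteVariation ν)
    (h : S → X) (hb : ∃ M : ℝ, ∀ s : S, ‖h s‖ ≤ M)
    (hz : semivariation ν {s : S | h s ≠ 0} = 0) :
    AbsRL ν h Set.univ (0 : X) := by
  obtain ⟨M, hM⟩ := hb
  intro ε hε
  have hM0 : 0 ≤ M := (norm_nonneg _).trans (hM (Classical.arbitrary S))
  obtain ⟨B, hBm, hhB, hB⟩ := exists_variation_lt_of_semivariation_eq_zero hz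
    (div_pos hε (by positivity : 0 < M + 1))
  obtain ⟨P₀, hP₀, hsub⟩ := exists_isCtblePartition_univ_pair hBm
  refine ⟨P₀, hP₀, fun P hP hfine => ⟨fun n _ => ⟨M, fun s _ => hM s⟩, fun t ht => ?_⟩⟩
  classical
  let A : ℕ → Set S := fun n => if P n ⊆ B then P n else ∅
  have hAP : ∀ n, A n ⊆ P n := fun n => by
    dsimp only [A]
    split_ifs <;> simp
  have hAm : ∀ n, MeasurableSet (A n) := fun n => by
    dsimp only [A]
    split_ifs
    exacts [hP.1 n, MeasurableSet.empty]
  have hAB : ∀ n, A n ⊆ B := fun n => by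
    dsimp only [A]
    split_ifs with hn
    exacts [hn, Set.empty_subset _]
  have hAd : Pairwise (Function.onFun Disjoint A) := fun i j hij =>
    (hP.2.1 hij).mono (hAP i) (hAP j)
  have hterm : ∀ n, ‖ν (P n) • h (t n)‖ ≤ M * ν (A n) := fun n => by
    by_cases hn : P n ⊆ B
    · rw [norm_smul, Real.norm_of_nonneg (hνnn _ (hP.1 n)), mul_comm, show A n = P n from if_pos hn]
      exact mul_le_mul_of_nonneg_right (hM _) (hνnn _ (hP.1 n))
    · have hne : (P n).Nonempty := Set.nonempty_iff_ne_empty.2 fun he => hn (by simp [he])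
      obtain ⟨m, hm⟩ := hfine n
      have hc : P n ⊆ Bᶜ := hm.trans ((hsub m).resolve_left fun hmB => hn (hm.trans hmB))
      have h0 : h (t n) = 0 := by
        by_contra h0
        exact hc (ht n hne) (hhB h0)
      rw [h0, smul_zero, norm_zero]
      exact mul_nonneg hM0 (hνnn _ (hAm n))
  have hsum : ∀ n, ∑ i ∈ Finset.range n, ‖ν (P i) • h (t i)‖ ≤ M * variation ν B := fun n =>
    calc ∑ i ∈ Finset.range n, ‖ν (P i) • h (t i)‖
        ≤ ∑ i ∈ Finset.range n, M * ν (A i) := Finset.sum_le_sum fun i _ => hterm i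
      _ = M * ∑ i ∈ Finset.range n, ν (A i) := (Finset.mul_sum _ _ _).symm
      _ ≤ M * variation ν B :=
        mul_le_mul_of_nonneg_left (sum_range_le_variation hfv hAm hAd hAB n) hM0
  have hs : Summable fun n => ‖ν (P n) • h (t n)‖ :=
    summable_of_sum_range_le (fun _ => norm_nonneg _) hsum
  refine ⟨hs, ?_⟩
  rw [sub_zero]
  calc ‖∑' n, ν (P n) • h (t n)‖ ≤ ∑' n, ‖ν (P n) • h (t n)‖ := norm_tsum_le_tsum_norm hs
    _ ≤ M * variation ν B := Real.tsum_le_of_sum_range_le (fun _ => norm_nonneg _) hsum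
    _ ≤ M * (ε / (M + 1)) := mul_le_mul_of_nonneg_left hB.le hM0
    _ < ε := by
      rw [← mul_div_assoc, div_lt_iff₀ (by positivity)]
      linarith
end

section
/- Let ν be of finite variation, h : S → X bounded (hence |RL| ν-integrable on every E ∈ 𝒞), and T_h(E) = (|RL|)∫_E h dν. If ν̄ is o-continuous (i.e. ν̄(A_n) → 0 for every decreasing sequence (A_n) ⊆ 𝒞 with ∩_n A_n = ∅), then ‖T_h(A_n)‖ → 0 for every such sequence; if ν̄ is exhaustive (i.e. ν̄(A_n) → 0 for every sequence of pairwise disjoint sets (A_n) ⊆ 𝒞), then ‖T_h(A_n)‖ → 0 for every sequence of pairwise disjoint sets in 𝒞. -/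
open Filter Topology

theorem sum_le_variation {S : Type*} [MeasurableSpace S] {ν : Set S → ℝ}
    (hfv : FiniteVariation ν) {E : Set S} {P : ℕ → Set S} (hP : IsCtblePartition E P) (n : ℕ) :
    ∑ i ∈ Finset.range n, ν (P i) ≤ variation ν E := by
  obtain ⟨hmeas, hdisj, hunion⟩ := hP
  refine le_csSup (hfv.mono ?_) ⟨n, fun i => P i, fun i => hmeas i,
    fun i => hunion ▸ Set.subset_iUnion P i,
    fun i j hij => hdisj fun h => hij (Fin.ext h), (Fin.sum_univ_eq_sum_range _ n).symm⟩
  rintro x ⟨k, A, hA, -, hd, rfl⟩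
  exact ⟨k, A, hA, fun _ => Set.subset_univ _, hd, rfl⟩

theorem AbsRL.norm_le_mul_variation {S : Type*} [Nonempty S] [MeasurableSpace S]
    {X : Type*} [NormedAddCommGroup X] [NormedSpace ℝ X] {ν : Set S → ℝ}
    (hνnn : ∀ A : Set S, MeasurableSet A → 0 ≤ ν A) (hfv : FiniteVariation ν)
    {h : S → X} {M : ℝ} (hM : ∀ s, ‖h s‖ ≤ M) {E : Set S} {a : X} (ha : AbsRL ν h E a) :
    ‖a‖ ≤ M * variation ν E := by
  classical
  have hM0 : 0 ≤ M := (norm_nonneg _).trans (hM (Classical.arbitrary S))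
  refine le_of_forall_pos_le_add fun ε hε => ?_
  obtain ⟨P, hP, hfine⟩ := ha ε hε
  let t : ℕ → S := fun n => if hn : (P n).Nonempty then hn.some else Classical.arbitrary S
  have ht : AreTags P t := fun n hn => by
    simp only [t, dif_pos hn]
    exact hn.some_mem
  obtain ⟨hsum, hlt⟩ := (hfine P hP fun n => ⟨n, subset_rfl⟩).2 t ht
  have hbound : ‖∑' n, ν (P n) • h (t n)‖ ≤ M * variation ν E := by
    refine (norm_tsum_le_tsum_norm hsum).trans
      (Real.tsum_le_of_sum_range_le (fun _ => norm_nonneg _) fun n => ?_)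
    calc ∑ i ∈ Finset.range n, ‖ν (P i) • h (t i)‖
        ≤ ∑ i ∈ Finset.range n, M * ν (P i) := by
          refine Finset.sum_le_sum fun i _ => ?_
          have hi := hνnn _ (hP.1 i)
          rw [norm_smul, Real.norm_of_nonneg hi, mul_comm]
          exact mul_le_mul_of_nonneg_right (hM _) hi
      _ = M * ∑ i ∈ Finset.range n, ν (P i) := (Finset.mul_sum _ _ _).symm
      _ ≤ M * variation ν E := mul_le_mul_of_nonneg_left (sum_le_variation hfv hP n) hM0
  have htri := norm_le_norm_add_norm_sub (∑' n, ν (P n) • h (t n)) a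
  linarith

/-- the indefinite integral `T_h` inherits o-continuity and exhaustivity
from the variation `ν̄`. -/
theorem absRL_integralOperator_oContinuous_exhaustive
    {S : Type*} [Nonempty S] [MeasurableSpace S]
    {X : Type*} [NormedAddCommGroup X] [NormedSpace ℝ X] [CompleteSpace X]
    (ν : Set S → ℝ) (hν0 : ν ∅ = 0) (hνnn : ∀ A : Set S, MeasurableSet A → 0 ≤ ν A)
    (hfv : FiniteVariation ν)
    (h : S → X) (hb : ∃ M : ℝ, ∀ s : S, ‖h s‖ ≤ M)
    (T : Set S → X) (hT : ∀ E : Set S, MeasurableSet E → AbsRL ν h E (T E)) :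
    ((∀ A : ℕ → Set S, (∀ n, MeasurableSet (A n)) → Antitone A → (⋂ n, A n) = ∅ →
        Filter.Tendsto (fun n => variation ν (A n)) Filter.atTop (nhds 0)) →
      ∀ A : ℕ → Set S, (∀ n, MeasurableSet (A n)) → Antitone A → (⋂ n, A n) = ∅ →
        Filter.Tendsto (fun n => ‖T (A n)‖) Filter.atTop (nhds 0)) ∧
    ((∀ A : ℕ → Set S, (∀ n, MeasurableSet (A n)) → Pairwise (Function.onFun Disjoint A) →
        Filter.Tendsto (fun n => variation ν (A n)) Filter.atTop (nhds 0)) →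
      ∀ A : ℕ → Set S, (∀ n, MeasurableSet (A n)) → Pairwise (Function.onFun Disjoint A) →
        Filter.Tendsto (fun n => ‖T (A n)‖) Filter.atTop (nhds 0)) := by
  obtain ⟨M, hM⟩ := hb
  have key : ∀ A : ℕ → Set S, (∀ n, MeasurableSet (A n)) →
      Tendsto (fun n => variation ν (A n)) atTop (𝓝 0) →
      Tendsto (fun n => ‖T (A n)‖) atTop (𝓝 0) := fun A hA hv =>
    squeeze_zero (fun _ => norm_nonneg _)
      (fun n => (hT (A n) (hA n)).norm_le_mul_variation hνnn hfv hM)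
      (by simpa using hv.const_mul M)
  exact ⟨fun hv A hA hanti hinter => key A hA (hv A hA hanti hinter),
    fun hv A hA hdisj => key A hA (hv A hA hdisj)⟩
end

section
/- Let ν be monotone (ν(A) ≤ ν(B) whenever A ⊆ B in 𝒞) and let h : S → [0,∞) be |RL| ν-integrable on every E ∈ 𝒞. Then the set function T_h(E) = (|RL|)∫_E h dν is monotone: for all A, B ∈ 𝒞 with A ⊆ B, T_h(A) ≤ T_h(B). -/
open Filter Topology

namespace IsCtblePartition

variable {S : Type*} [MeasurableSpace S]

/-- The trace of a partition of `E` on a measurable set `F` is a partition of `E ∩ F`. -/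
theorem inter_set {E F : Set S} {P : ℕ → Set S} (hP : IsCtblePartition E P)
    (hF : MeasurableSet F) : IsCtblePartition (E ∩ F) fun n => P n ∩ F :=
  ⟨fun n => (hP.1 n).inter hF,
    fun _ _ hij => (hP.2.1 hij).mono Set.inter_subset_left Set.inter_subset_left,
    by rw [← Set.iUnion_inter, hP.2.2]⟩

/-- The common refinement of a partition of `E` and a partition of `F`, enumerated by the
pairing function, is a partition of `E ∩ F`. -/
theorem inter_unpair {E F : Set S} {P Q : ℕ → Set S} (hP : IsCtblePartition E P)
    (hQ : IsCtblePartition F Q) :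
    IsCtblePartition (E ∩ F) fun k => P k.unpair.1 ∩ Q k.unpair.2 := by
  refine ⟨fun k => (hP.1 _).inter (hQ.1 _), fun i j hij => ?_, ?_⟩
  · by_cases h₁ : i.unpair.1 = j.unpair.1
    · have h₂ : i.unpair.2 ≠ j.unpair.2 := fun h₂ => hij <| by
        rw [← Nat.pair_unpair i, ← Nat.pair_unpair j, h₁, h₂]
      exact (hQ.2.1 h₂).mono Set.inter_subset_right Set.inter_subset_right
    · exact (hP.2.1 h₁).mono Set.inter_subset_left Set.inter_subset_left
  · rw [← hP.2.2, ← hQ.2.2, Set.iUnion_inter_iUnion]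
    exact Set.iUnion_unpair fun m n => P m ∩ Q n

/-- Adding the complement of `E` to a partition of `E` gives a partition of the whole space. -/
theorem cons_compl {E : Set S} {P : ℕ → Set S} (hP : IsCtblePartition E P)
    (hE : MeasurableSet E) :
    IsCtblePartition Set.univ fun n => Nat.casesOn (motive := fun _ => Set S) n Eᶜ P := by
  have hsub (n : ℕ) : P n ⊆ E := hP.2.2 ▸ Set.subset_iUnion P n
  refine ⟨?_, ?_, ?_⟩
  · rintro (_ | n)
    · exact hE.compl
    · exact hP.1 n
  · rintro (_ | i) (_ | j) hij
    · exact absurd rfl hij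
    · exact (disjoint_compl_left (a := E)).mono_right (hsub j)
    · exact (disjoint_compl_right (a := E)).mono_left (hsub i)
    · exact hP.2.1 fun h => hij (congrArg Nat.succ h)
  · refine Set.eq_univ_of_forall fun x => ?_
    by_cases hx : x ∈ E
    · rw [← hP.2.2] at hx
      obtain ⟨n, hn⟩ := Set.mem_iUnion.1 hx
      exact Set.mem_iUnion.2 ⟨n + 1, hn⟩
    · exact Set.mem_iUnion.2 ⟨0, hx⟩

end IsCtblePartition

/-- If `Q n ⊆ P n` for all `n`, some choice of tags serves both `P` and `Q`. -/
theorem exists_common_tags {S : Type*} [Nonempty S] {P Q : ℕ → Set S} (hQP : ∀ n, Q n ⊆ P n) :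
    ∃ t : ℕ → S, AreTags P t ∧ AreTags Q t := by
  have key (n : ℕ) : ∃ s : S, ((P n).Nonempty → s ∈ P n) ∧ ((Q n).Nonempty → s ∈ Q n) := by
    by_cases hQ : (Q n).Nonempty
    · obtain ⟨s, hs⟩ := hQ
      exact ⟨s, fun _ => hQP n hs, fun _ => hs⟩
    · by_cases hP : (P n).Nonempty
      · obtain ⟨s, hs⟩ := hP
        exact ⟨s, fun _ => hs, fun h => absurd h hQ⟩
      · exact ⟨Classical.arbitrary S, fun h => absurd h hP, fun h => absurd h hQ⟩
  choose t ht using key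
  exact ⟨t, fun n => (ht n).1, fun n => (ht n).2⟩

/-- if `ν` is monotone and `h ≥ 0` is `|RL|` `ν`-integrable on every
measurable set, then the indefinite integral `T_h` is monotone. -/
theorem absRL_integralOperator_monotone
    {S : Type*} [Nonempty S] [MeasurableSpace S]
    (ν : Set S → ℝ) (hν0 : ν ∅ = 0) (hνnn : ∀ A : Set S, MeasurableSet A → 0 ≤ ν A)
    (hmono : ∀ A B : Set S, MeasurableSet A → MeasurableSet B → A ⊆ B → ν A ≤ ν B)
    (h : S → ℝ) (hpos : ∀ s : S, 0 ≤ h s)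
    (T : Set S → ℝ) (hT : ∀ E : Set S, MeasurableSet E → AbsRL ν h E (T E)) :
    ∀ A B : Set S, MeasurableSet A → MeasurableSet B → A ⊆ B → T A ≤ T B := by
  intro A B hA hB hAB
  refine le_of_forall_pos_le_add fun ε hε => ?_
  obtain ⟨PA, hPA, hTA⟩ := hT A hA (ε / 2) (half_pos hε)
  obtain ⟨PB, hPB, hTB⟩ := hT B hB (ε / 2) (half_pos hε)
  have hR := (hPA.cons_compl hA).inter_unpair hPB
  rw [Set.univ_inter] at hR
  set R : ℕ → Set S := fun k =>
    Nat.casesOn (motive := fun _ => Set S) k.unpair.1 Aᶜ PA ∩ PB k.unpair.2 with hRdef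
  have hQ := hR.inter_set hA
  rw [Set.inter_eq_self_of_subset_right hAB] at hQ
  have hRfine : FinerThan PB R := fun k => ⟨k.unpair.2, Set.inter_subset_right⟩
  have hQfine : FinerThan PA fun k => R k ∩ A := by
    intro k
    rcases hk : k.unpair.1 with _ | m
    · refine ⟨0, fun x hx => ?_⟩
      simp only [hRdef, hk] at hx
      exact absurd hx.2 hx.1.1
    · refine ⟨m, fun x hx => ?_⟩
      simp only [hRdef, hk] at hx
      exact hx.1.1
  obtain ⟨t, htR, htQ⟩ := exists_common_tags (P := R) (Q := fun k => R k ∩ A)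
    fun k => Set.inter_subset_left
  obtain ⟨hsA, hdA⟩ := (hTA _ hQ hQfine).2 t htQ
  obtain ⟨hsB, hdB⟩ := (hTB R hR hRfine).2 t htR
  have hle : ∑' k, ν (R k ∩ A) • h (t k) ≤ ∑' k, ν (R k) • h (t k) :=
    hsA.of_norm.tsum_le_tsum (fun k => mul_le_mul_of_nonneg_right
      (hmono _ _ (hQ.1 k) (hR.1 k) Set.inter_subset_left) (hpos _)) hsB.of_norm
  rw [Real.norm_eq_abs, abs_lt] at hdA hdB
  linarith [hdA.1, hdB.2]
end

section
/- Let ν be monotone, σ-subadditive and of finite variation, and let h : S → ℝ be bounded. Then h is RL ν-integrable on S if and only if h is Gould ν-integrable on S, and in this case the two integrals coincide. -/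
open Filter Topology

section SetFunction

variable {S : Type*} [MeasurableSpace S] {ν : Set S → ℝ}

theorem FiniteVariation.bddAbove (hfv : FiniteVariation ν) (E : Set S) :
    BddAbove (variationSet ν E) := by
  refine BddAbove.mono ?_ hfv
  rintro x ⟨k, A, hA, -, hd, rfl⟩
  exact ⟨k, A, hA, fun i => Set.subset_univ _, hd, rfl⟩

theorem sum_mem_variationSet {ι : Type*} [Fintype ι] {A : ι → Set S} {E : Set S}
    (hA : ∀ i, MeasurableSet (A i)) (hE : ∀ i, A i ⊆ E)
    (hd : Pairwise (Function.onFun Disjoint A)) :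
    ∑ i, ν (A i) ∈ variationSet ν E := by
  let e := (Fintype.equivFin ι).symm
  refine ⟨Fintype.card ι, fun i => A (e i), fun i => hA _, fun i => hE _, ?_, ?_⟩
  · exact fun i j hij => hd (e.injective.ne hij)
  · exact (Equiv.sum_comp e fun i => ν (A i)).symm

theorem sum_le_variation_s14 (hfv : FiniteVariation ν) {ι : Type*} [Fintype ι] {A : ι → Set S}
    {E : Set S} (hA : ∀ i, MeasurableSet (A i)) (hE : ∀ i, A i ⊆ E)
    (hd : Pairwise (Function.onFun Disjoint A)) :
    ∑ i, ν (A i) ≤ variation ν E :=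
  le_csSup (hfv.bddAbove E) (sum_mem_variationSet hA hE hd)

theorem variationSet_nonempty (E : Set S) : (variationSet ν E).Nonempty :=
  ⟨_, sum_mem_variationSet (ι := Empty) (A := fun _ => ∅) (by simp) (by simp)
    (fun i => i.elim)⟩

theorem variation_nonneg (hfv : FiniteVariation ν) (E : Set S) : 0 ≤ variation ν E := by
  simpa using sum_le_variation_s14 (ι := Empty) (A := fun _ => ∅) (E := E) hfv (by simp) (by simp)
    (fun i => i.elim)

theorem variation_mono (hfv : FiniteVariation ν) {E F : Set S} (hEF : E ⊆ F) :
    variation ν E ≤ variation ν F := by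
  refine csSup_le_csSup (hfv.bddAbove F) (variationSet_nonempty E) ?_
  rintro x ⟨k, A, hA, hE, hd, rfl⟩
  exact ⟨k, A, hA, fun i => (hE i).trans hEF, hd, rfl⟩

theorem variation_add_le_union (hfv : FiniteVariation ν) {E F : Set S} (hEF : Disjoint E F) :
    variation ν E + variation ν F ≤ variation ν (E ∪ F) := by
  rw [← le_sub_iff_add_le]
  refine csSup_le (variationSet_nonempty E) ?_
  rintro x ⟨k, A, hA, hE, hAd, rfl⟩
  rw [le_sub_comm]
  refine csSup_le (variationSet_nonempty F) ?_
  rintro y ⟨l, B, hB, hF, hBd, rfl⟩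
  rw [le_sub_iff_add_le, add_comm]
  have := sum_le_variation_s14 (ι := Fin k ⊕ Fin l) (A := Sum.elim A B) (E := E ∪ F) hfv
    (by rintro (i | i) <;> simp [hA, hB])
    (by
      rintro (i | i)
      · exact (hE i).trans Set.subset_union_left
      · exact (hF i).trans Set.subset_union_right)
    (by
      rintro (i | i) (j | j) hij
      · exact hAd (fun h => hij (by rw [h]))
      · exact hEF.mono (hE i) (hF j)
      · exact (hEF.mono (hE j) (hF i)).symm
      · exact hBd (fun h => hij (by rw [h])))
  simpa using this

theorem sum_variation_le_biUnion (hfv : FiniteVariation ν) {ι : Type*} {C : ι → Set S}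
    (hd : Pairwise (Function.onFun Disjoint C)) (s : Finset ι) :
    ∑ i ∈ s, variation ν (C i) ≤ variation ν (⋃ i ∈ s, C i) := by
  classical
  induction s using Finset.induction_on with
  | empty => simpa using variation_nonneg hfv _
  | insert i s hi ih =>
    rw [Finset.sum_insert hi, Finset.set_biUnion_insert]
    refine (add_le_add_right ih _).trans (variation_add_le_union hfv ?_)
    simp only [Set.disjoint_iUnion_right]
    exact fun j hj => hd (fun h => hi (h ▸ hj))

theorem summable_variation (hfv : FiniteVariation ν) {ι : Type*} {C : ι → Set S}
    (hd : Pairwise (Function.onFun Disjoint C)) : Summable fun i => variation ν (C i) :=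
  summable_of_sum_le (fun _ => variation_nonneg hfv _) fun s =>
    (sum_variation_le_biUnion hfv hd s).trans (variation_mono hfv (Set.subset_univ _))

theorem summable_of_pairwise_disjoint (hνnn : ∀ A : Set S, MeasurableSet A → 0 ≤ ν A)
    (hfv : FiniteVariation ν) {ι : Type*} {C : ι → Set S} (hC : ∀ i, MeasurableSet (C i))
    (hd : Pairwise (Function.onFun Disjoint C)) : Summable fun i => ν (C i) := by
  refine Summable.of_nonneg_of_le (fun i => hνnn _ (hC i)) (fun i => ?_) (summable_variation hfv hd)
  simpa using sum_le_variation_s14 (ι := Unit) (A := fun _ => C i) (E := C i) hfv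
    (fun _ => hC i) (fun _ => subset_rfl) (fun i j hij => (hij rfl).elim)

theorem le_tsum_of_pairwise_disjoint (hνnn : ∀ A : Set S, MeasurableSet A → 0 ≤ ν A)
    (hσsub : ∀ (A : Set S) (B : ℕ → Set S), MeasurableSet A →
      (∀ n, MeasurableSet (B n)) → A = ⋃ n, B n →
      ENNReal.ofReal (ν A) ≤ ∑' n, ENNReal.ofReal (ν (B n)))
    (hfv : FiniteVariation ν) {A : Set S} {B : ℕ → Set S} (hB : ∀ n, MeasurableSet (B n))
    (hd : Pairwise (Function.onFun Disjoint B)) (hA : A = ⋃ n, B n) :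
    ν A ≤ ∑' n, ν (B n) := by
  have h1 := hσsub A B (hA ▸ MeasurableSet.iUnion hB) hB hA
  rw [← ENNReal.ofReal_tsum_of_nonneg (fun n => hνnn _ (hB n))
    (summable_of_pairwise_disjoint hνnn hfv hB hd)] at h1
  exact (ENNReal.ofReal_le_ofReal_iff (tsum_nonneg fun n => hνnn _ (hB n))).1 h1

theorem pairwise_disjoint_inter_left {α ι : Type*} {C : ι → Set α}
    (hd : Pairwise (Function.onFun Disjoint C)) (E : Set α) :
    Pairwise (Function.onFun Disjoint fun i => E ∩ C i) :=
  fun _ _ hij => (hd hij).mono Set.inter_subset_right Set.inter_subset_right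

theorem pairwise_disjoint_comp {α ι κ : Type*} {C : ι → Set α}
    (hd : Pairwise (Function.onFun Disjoint C)) {f : κ → ι} (hf : Function.Injective f) :
    Pairwise (Function.onFun Disjoint fun i => C (f i)) :=
  fun _ _ hij => hd (hf.ne hij)

theorem exists_tag {α ι : Type*} [Nonempty α] (Q : ι → Set α) :
    ∃ t : ι → α, ∀ i, (Q i).Nonempty → t i ∈ Q i := by
  choose t ht using fun i => show ∃ x : α, (Q i).Nonempty → x ∈ Q i by
    by_cases hi : (Q i).Nonempty
    · exact ⟨hi.some, fun _ => hi.some_mem⟩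
    · exact ⟨Classical.arbitrary α, fun h => (hi h).elim⟩
  exact ⟨t, ht⟩

theorem AbsRL.gould [Nonempty S] (hν0 : ν ∅ = 0)
    (hνnn : ∀ A : Set S, MeasurableSet A → 0 ≤ ν A)
    (hσsub : ∀ (A : Set S) (B : ℕ → Set S), MeasurableSet A →
      (∀ n, MeasurableSet (B n)) → A = ⋃ n, B n →
      ENNReal.ofReal (ν A) ≤ ∑' n, ENNReal.ofReal (ν (B n)))
    (hfv : FiniteVariation ν) {h : S → ℝ} {M : ℝ} (hM : 0 < M) (hb : ∀ s, |h s| ≤ M) {a : ℝ}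
    (hRL : AbsRL ν h Set.univ a) : Gould ν h Set.univ a := by
  intro ε hε
  obtain ⟨C, ⟨hCm, hCd, hCu⟩, hC⟩ := hRL (ε / 2) (by positivity)
  have hw := summable_variation hfv hCd
  obtain ⟨N, hN⟩ := ((tendsto_sum_nat_add fun n => variation ν (C n)).eventually_lt_const
    (show 0 < ε / (4 * M) by positivity)).exists
  let T : Set S := ⋃ n, C (n + N)
  have hTd : ∀ n < N, Disjoint (C n) T := by
    intro n hn
    simp only [T, Set.disjoint_iUnion_right]
    exact fun m => hCd (by omega)
  refine ⟨N + 1, fun i => if (i : ℕ) < N then C i else T, ⟨?_, ?_, ?_⟩, ?_⟩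
  · intro i
    dsimp only
    split_ifs
    · exact hCm _
    · exact MeasurableSet.iUnion fun _ => hCm _
  · intro i j hij
    have hij' : (i : ℕ) ≠ j := fun h => hij (Fin.ext h)
    dsimp only [Function.onFun]
    split_ifs with hi hj hj
    · exact hCd hij'
    · exact hTd _ hi
    · exact (hTd _ hj).symm
    · omega
  · refine Set.eq_univ_of_forall fun x => ?_
    obtain ⟨n, hn⟩ := Set.mem_iUnion.1 (hCu ▸ Set.mem_univ x)
    rw [Set.mem_iUnion]
    by_cases hnN : n < N
    · exact ⟨⟨n, by omega⟩, by simpa [hnN] using hn⟩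
    · refine ⟨Fin.last N, ?_⟩
      simp only [Fin.val_last, lt_irrefl, if_false, T, Set.mem_iUnion]
      exact ⟨n - N, by rwa [Nat.sub_add_cancel (not_lt.1 hnN)]⟩
  intro l E ⟨hEm, hEd, hEu⟩ hfin t ht
  have : Nonempty (Fin l) := by
    obtain ⟨x⟩ := ‹Nonempty S›
    obtain ⟨i, -⟩ := Set.mem_iUnion.1 (hEu ▸ Set.mem_univ x)
    exact ⟨i⟩
  obtain ⟨e⟩ : Nonempty (ℕ ≃ Fin l × ℕ) := nonempty_equiv_of_countable
  let Q : Fin l × ℕ → Set S := fun p => E p.1 ∩ C p.2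
  have hQm : ∀ p, MeasurableSet (Q p) := fun p => (hEm _).inter (hCm _)
  have hQd : Pairwise (Function.onFun Disjoint Q) := by
    rintro ⟨i, m⟩ ⟨j, n⟩ hne
    by_cases hij : i = j
    · have hmn : m ≠ n := fun hmn => hne (by rw [hij, hmn])
      exact (hCd hmn).mono Set.inter_subset_right Set.inter_subset_right
    · exact (hEd hij).mono Set.inter_subset_left Set.inter_subset_left
  obtain ⟨u, hu⟩ := exists_tag Q
  classical
  let s : Fin l × ℕ → S := fun p => if t p.1 ∈ Q p then t p.1 else u p
  have hs : ∀ p, (Q p).Nonempty → s p ∈ Q p := by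
    intro p hp
    dsimp only [s]
    split_ifs with hp'
    · exact hp'
    · exact hu p hp
  obtain ⟨-, hQ⟩ := hC (fun k => Q (e k))
    ⟨fun k => hQm _, pairwise_disjoint_comp hQd e.injective, by
      refine Set.eq_univ_of_forall fun x => ?_
      obtain ⟨n, hn⟩ := Set.mem_iUnion.1 (hCu ▸ Set.mem_univ x)
      obtain ⟨j, hj⟩ := Set.mem_iUnion.1 (hEu ▸ Set.mem_univ x)
      exact Set.mem_iUnion.2 ⟨e.symm (j, n), by simpa [Q] using ⟨hj, hn⟩⟩⟩
    (fun k => ⟨(e k).2, Set.inter_subset_right⟩)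
  obtain ⟨hsum, hlt⟩ := hQ (fun k => s (e k)) (fun k => hs _)
  let f : Fin l × ℕ → ℝ := fun p => ν (Q p) * h (s p)
  have hf : Summable f := e.summable_iff.1 (Summable.of_norm hsum)
  have hlt : |∑ j, ∑' n, f (j, n) - a| < ε / 2 := by
    have h1 : ∑' k, ν (Q (e k)) • h (s (e k)) = ∑ j, ∑' n, f (j, n) := by
      rw [← tsum_fintype (L := .unconditional _) (fun j => ∑' n, f (j, n)), ← hf.tsum_prod]
      exact e.tsum_eq f
    rwa [h1, Real.norm_eq_abs] at hlt
  have hQs : Summable fun p => ν (Q p) := summable_of_pairwise_disjoint hνnn hfv hQm hQd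
  have hQj : ∀ j, Summable fun n => ν (Q (j, n)) := fun j => hQs.prod_factor j
  have hQjN : ∀ j, Summable fun n => ν (Q (j, n + N)) := fun j => (summable_nat_add_iff N).2 (hQj j)
  have hdiff : ∀ j, |ν (E j) * h (t j) - ∑' n, f (j, n)| ≤ 2 * M * ∑' n, ν (Q (j, n + N)) := by
    intro j
    have hnn : 0 ≤ ∑' n, ν (Q (j, n + N)) := tsum_nonneg fun n => hνnn _ (hQm _)
    obtain ⟨i, hi⟩ := hfin j
    dsimp only at hi
    by_cases hiN : (i : ℕ) < N
    · rw [if_pos hiN] at hi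
      have h0 : ∀ n, n ≠ (i : ℕ) → f (j, n) = 0 := by
        intro n hn
        have : Q (j, n) = ∅ := by
          rw [← Set.disjoint_iff_inter_eq_empty]
          exact (hCd hn.symm).mono_left hi
        simp [f, this, hν0]
      have hQi : Q (j, (i : ℕ)) = E j := Set.inter_eq_left.2 hi
      have h1 : f (j, (i : ℕ)) = ν (E j) * h (t j) := by
        rcases (E j).eq_empty_or_nonempty with hE | hE
        · simp [f, hQi, hE, hν0]
        · have : s (j, (i : ℕ)) = t j := if_pos (by rw [hQi]; exact ht j hE)
          simp only [f, hQi, this]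
      rw [tsum_eq_single (i : ℕ) h0, h1, sub_self, abs_zero]
      positivity
    · rw [if_neg hiN] at hi
      have h0 : ∀ n < N, ν (Q (j, n)) = 0 := by
        intro n hn
        have : Q (j, n) = ∅ := by
          rw [← Set.disjoint_iff_inter_eq_empty]
          exact ((hTd n hn).symm).mono_left hi
        rw [this, hν0]
      have htail : ∑' n, ν (Q (j, n)) = ∑' n, ν (Q (j, n + N)) := by
        rw [← (hQj j).sum_add_tsum_nat_add N,
          Finset.sum_eq_zero fun n hn => h0 n (Finset.mem_range.1 hn), zero_add]
      have hE : ν (E j) ≤ ∑' n, ν (Q (j, n)) :=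
        le_tsum_of_pairwise_disjoint hνnn hσsub hfv (fun n => hQm _)
          (pairwise_disjoint_inter_left hCd (E j))
          (by simp only [Q, ← Set.inter_iUnion, hCu, Set.inter_univ])
      have h1 : |ν (E j) * h (t j)| ≤ M * ∑' n, ν (Q (j, n)) := by
        rw [abs_mul, abs_of_nonneg (hνnn _ (hEm j)), mul_comm]
        exact mul_le_mul (hb _) hE (hνnn _ (hEm j)) hM.le
      have h2 : |∑' n, f (j, n)| ≤ M * ∑' n, ν (Q (j, n)) := by
        rw [← Real.norm_eq_abs]
        refine tsum_of_norm_bounded ((hQj j).hasSum.mul_left M) fun n => ?_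
        rw [Real.norm_eq_abs, abs_mul, abs_of_nonneg (hνnn _ (hQm _)), mul_comm]
        exact mul_le_mul_of_nonneg_right (hb _) (hνnn _ (hQm _))
      rw [← htail]
      linarith [abs_sub (ν (E j) * h (t j)) (∑' n, f (j, n))]
  have hsumtail : ∑ j, ∑' n, ν (Q (j, n + N)) < ε / (4 * M) := by
    rw [← Summable.tsum_finsetSum fun j _ => hQjN j]
    refine lt_of_le_of_lt (Summable.tsum_le_tsum (fun n => ?_)
      (summable_sum fun j _ => hQjN j) ((summable_nat_add_iff N).2 hw)) hN
    refine sum_le_variation_s14 hfv (fun j => hQm _) (fun j => Set.inter_subset_right) ?_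
    exact fun i j hij => (hEd hij).mono Set.inter_subset_left Set.inter_subset_left
  have hmain : |∑ j, ν (E j) * h (t j) - ∑ j, ∑' n, f (j, n)| < ε / 2 := by
    rw [← Finset.sum_sub_distrib]
    refine (Finset.abs_sum_le_sum_abs _ _).trans_lt
      ((Finset.sum_le_sum fun j _ => hdiff j).trans_lt ?_)
    rw [← Finset.mul_sum]
    calc _ < 2 * M * (ε / (4 * M)) := by gcongr
      _ = ε / 2 := by field_simp; norm_num
  linarith [abs_sub_le (∑ j, ν (E j) * h (t j)) (∑ j, ∑' n, f (j, n)) a]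

theorem Gould.absRL [Nonempty S] (hν0 : ν ∅ = 0)
    (hνnn : ∀ A : Set S, MeasurableSet A → 0 ≤ ν A)
    (hσsub : ∀ (A : Set S) (B : ℕ → Set S), MeasurableSet A →
      (∀ n, MeasurableSet (B n)) → A = ⋃ n, B n →
      ENNReal.ofReal (ν A) ≤ ∑' n, ENNReal.ofReal (ν (B n)))
    (hfv : FiniteVariation ν) {h : S → ℝ} {M : ℝ} (hM : 0 < M) (hb : ∀ s, |h s| ≤ M) {a : ℝ}
    (hG : Gould ν h Set.univ a) : AbsRL ν h Set.univ a := by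
  intro ε hε
  obtain ⟨k, C, ⟨hCm, hCd, hCu⟩, hC⟩ := hG (ε / 2) (by positivity)
  refine ⟨fun n => if hn : n < k then C ⟨n, hn⟩ else ∅, ⟨?_, ?_, ?_⟩, ?_⟩
  · intro n
    dsimp only
    split_ifs
    · exact hCm _
    · exact MeasurableSet.empty
  · intro m n hmn
    dsimp only [Function.onFun]
    split_ifs
    · exact hCd (fun h => hmn (by simpa using h))
    all_goals simp
  · refine Set.eq_univ_of_forall fun x => ?_
    obtain ⟨i, hi⟩ := Set.mem_iUnion.1 (hCu ▸ Set.mem_univ x)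
    exact Set.mem_iUnion.2 ⟨i, by simpa using hi⟩
  rintro P ⟨hPm, hPd, hPu⟩ hfin
  refine ⟨fun n _ => ⟨M, fun s _ => hb s⟩, fun t ht => ?_⟩
  have hfin' : ∀ n, (P n).Nonempty → ∃ i, P n ⊆ C i := by
    intro n hn
    obtain ⟨m, hm⟩ := hfin n
    dsimp only at hm
    split_ifs at hm with hmk
    · exact ⟨_, hm⟩
    · exact absurd (Set.subset_empty_iff.1 hm) hn.ne_empty
  have : Nonempty (Fin k) := by
    obtain ⟨x⟩ := ‹Nonempty S›
    obtain ⟨i, -⟩ := Set.mem_iUnion.1 (hCu ▸ Set.mem_univ x)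
    exact ⟨i⟩
  have hPs : Summable fun n => ν (P n) := summable_of_pairwise_disjoint hνnn hfv hPm hPd
  have hbd : ∀ n, ‖ν (P n) • h (t n)‖ ≤ M * ν (P n) := by
    intro n
    rw [smul_eq_mul, Real.norm_eq_abs, abs_mul, abs_of_nonneg (hνnn _ (hPm n)), mul_comm]
    exact mul_le_mul_of_nonneg_right (hb _) (hνnn _ (hPm n))
  have hsum : Summable fun n => ‖ν (P n) • h (t n)‖ :=
    Summable.of_nonneg_of_le (fun _ => norm_nonneg _) hbd (hPs.mul_left M)
  refine ⟨hsum, ?_⟩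
  suffices key : ∀ N, |∑ n ∈ Finset.range N, ν (P n) • h (t n) - a| ≤
      ε / 2 + M * ∑' n, ν (P (n + N)) by
    have h1 : Tendsto (fun N => |∑ n ∈ Finset.range N, ν (P n) • h (t n) - a|) atTop
        (𝓝 |∑' n, ν (P n) • h (t n) - a|) :=
      (hsum.of_norm.hasSum.tendsto_sum_nat.sub_const a).abs
    have h2 : Tendsto (fun N => ε / 2 + M * ∑' n, ν (P (n + N))) atTop (𝓝 (ε / 2 + M * 0)) :=
      ((tendsto_sum_nat_add fun n => ν (P n)).const_mul M).const_add _
    have := le_of_tendsto_of_tendsto' h1 h2 key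
    rw [Real.norm_eq_abs]
    linarith
  intro N
  let T : Set S := ⋃ n, P (n + N)
  have hTm : MeasurableSet T := MeasurableSet.iUnion fun _ => hPm _
  have hTd : ∀ n < N, Disjoint (P n) T := by
    intro n hn
    simp only [T, Set.disjoint_iUnion_right]
    exact fun m => hPd (by omega)
  obtain ⟨u, hu⟩ := exists_tag fun i => C i ∩ T
  let Q : Fin N ⊕ Fin k → Set S := Sum.elim (fun n => P n) fun i => C i ∩ T
  let s : Fin N ⊕ Fin k → S := Sum.elim (fun n => t n) u
  let e := (finSumFinEquiv (m := N) (n := k)).symm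
  have hQm : ∀ q, MeasurableSet (Q q) := by
    rintro (i | i)
    · exact hPm i
    · exact (hCm i).inter hTm
  have hQd : Pairwise (Function.onFun Disjoint Q) := by
    rintro (i | i) (j | j) hij
    · exact hPd (fun h => hij (by rw [Fin.ext h]))
    · exact (hTd i i.2).mono_right Set.inter_subset_right
    · exact ((hTd j j.2).mono_right Set.inter_subset_right).symm
    · exact (hCd fun h => hij (by rw [h])).mono Set.inter_subset_left Set.inter_subset_left
  have hQu : ∀ x, ∃ q, x ∈ Q q := by
    intro x
    obtain ⟨n, hn⟩ := Set.mem_iUnion.1 (hPu ▸ Set.mem_univ x)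
    by_cases hnN : n < N
    · exact ⟨Sum.inl ⟨n, hnN⟩, hn⟩
    · obtain ⟨i, hi⟩ := Set.mem_iUnion.1 (hCu ▸ Set.mem_univ x)
      exact ⟨Sum.inr i, hi, Set.mem_iUnion.2
        ⟨n - N, by rwa [Nat.sub_add_cancel (not_lt.1 hnN)]⟩⟩
  have hQ := hC (N + k) (fun j => Q (e j))
    ⟨fun j => hQm _, pairwise_disjoint_comp hQd e.injective, by
        refine Set.eq_univ_of_forall fun x => ?_
        obtain ⟨q, hq⟩ := hQu x
        exact Set.mem_iUnion.2 ⟨e.symm q, by simpa using hq⟩⟩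
    (fun j => by
      rcases e j with n | i
      · rcases (P n).eq_empty_or_nonempty with hn | hn
        · exact ⟨Classical.arbitrary _, by simp [Q, hn]⟩
        · exact hfin' n hn
      · exact ⟨i, Set.inter_subset_left⟩)
    (fun j => s (e j))
    (fun j => by
      rcases e j with n | i
      · exact ht n
      · exact hu i)
  rw [Equiv.sum_comp e fun q => ν (Q q) * h (s q), Fintype.sum_sum_type] at hQ
  simp only [Q, s, Sum.elim_inl, Sum.elim_inr] at hQ
  rw [Fin.sum_univ_eq_sum_range (fun n => ν (P n) * h (t n))] at hQ
  have hCPs : ∀ i, Summable fun n => ν (C i ∩ P (n + N)) := fun i =>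
    summable_of_pairwise_disjoint hνnn hfv (fun n => (hCm i).inter (hPm _))
      (pairwise_disjoint_inter_left (pairwise_disjoint_comp hPd (add_left_injective N)) _)
  have hsub : ∀ i, ν (C i ∩ T) ≤ ∑' n, ν (C i ∩ P (n + N)) := fun i =>
    le_tsum_of_pairwise_disjoint hνnn hσsub hfv (fun n => (hCm i).inter (hPm _))
      (pairwise_disjoint_inter_left (pairwise_disjoint_comp hPd (add_left_injective N)) _)
      (Set.inter_iUnion _ _)
  have hsplit : ∀ m, ∑ i, ν (C i ∩ P m) = ν (P m) := by
    intro m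
    rcases (P m).eq_empty_or_nonempty with hm | hm
    · simp [hm, hν0]
    · obtain ⟨i, hi⟩ := hfin' m hm
      rw [Finset.sum_eq_single i, Set.inter_eq_right.2 hi]
      · intro j _ hji
        rw [Set.disjoint_iff_inter_eq_empty.1 ((hCd hji).mono_right hi), hν0]
      · simp
  have htail : |∑ i, ν (C i ∩ T) * h (u i)| ≤ M * ∑' n, ν (P (n + N)) := by
    calc |∑ i, ν (C i ∩ T) * h (u i)| ≤ ∑ i, |ν (C i ∩ T) * h (u i)| :=
          Finset.abs_sum_le_sum_abs _ _
      _ ≤ ∑ i, M * ∑' n, ν (C i ∩ P (n + N)) := by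
          refine Finset.sum_le_sum fun i _ => ?_
          have hnn := hνnn _ ((hCm i).inter hTm)
          rw [abs_mul, abs_of_nonneg hnn, mul_comm]
          exact mul_le_mul (hb _) (hsub i) hnn hM.le
      _ = M * ∑' n, ν (P (n + N)) := by
          rw [← Finset.mul_sum, ← Summable.tsum_finsetSum fun i _ => hCPs i]
          simp only [hsplit]
  simp only [smul_eq_mul]
  rw [abs_lt] at hQ
  rw [abs_le] at htail ⊢
  constructor <;> linarith [hQ.1, hQ.2, htail.1, htail.2]

end SetFunction

/-- for `ν` monotone, `σ`-subadditive and of finite variation, a bounded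
real function is `RL` `ν`-integrable iff it is Gould `ν`-integrable, with the same
integral. -/
theorem absRL_iff_gould
    {S : Type*} [Nonempty S] [MeasurableSpace S]
    (ν : Set S → ℝ) (hν0 : ν ∅ = 0) (hνnn : ∀ A : Set S, MeasurableSet A → 0 ≤ ν A)
    (hmono : ∀ A B : Set S, MeasurableSet A → MeasurableSet B → A ⊆ B → ν A ≤ ν B)
    (hσsub : ∀ (A : Set S) (B : ℕ → Set S), MeasurableSet A →
      (∀ n, MeasurableSet (B n)) → A = ⋃ n, B n →
      ENNReal.ofReal (ν A) ≤ ∑' n, ENNReal.ofReal (ν (B n)))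
    (hfv : FiniteVariation ν)
    (h : S → ℝ) (hb : ∃ M : ℝ, ∀ s : S, |h s| ≤ M)
    (a : ℝ) :
    AbsRL ν h Set.univ a ↔ Gould ν h Set.univ a := by
  obtain ⟨M, hM⟩ := hb
  have hM' : ∀ s, |h s| ≤ max M 1 := fun s => (hM s).trans (le_max_left _ _)
  have hpos : 0 < max M 1 := lt_max_of_lt_right one_pos
  exact ⟨fun hRL => hRL.gould hν0 hνnn hσsub hfv hpos hM',
    fun hG => hG.absRL hν0 hνnn hσsub hfv hpos hM'⟩
end
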